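/- A consistent path system P on the vertex set [n] is metric if and only if there exists a metric ρ on [n] such that T(P) ⊆ T(ρ). -/

import Mathlib

open SimpleGraph

/-- A path system on a simple graph `G`: for every pair of distinct vertices a chosen
simple path between them, with `P_{u,v} = P_{v,u}`. -/
structure PathSystem {V : Type*} (G : SimpleGraph V) where
  path : ∀ u v : V, u ≠ v → G.Path u v
  symm : ∀ (u v : V) (h : u ≠ v), (path v u (Ne.symm h)).val = (path u v h).val.reverse

namespace PathSystem

variable {V : Type*} {G : SimpleGraph V}

/-- A path system is consistent if whenever `a` lies on `P_{u,v}`, the path `P_{u,v}` is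
the concatenation of `P_{u,a}` and `P_{a,v}`. -/
def Consistent (P : PathSystem G) : Prop :=
  ∀ (u v : V) (huv : u ≠ v) (a : V) (hua : u ≠ a) (hav : a ≠ v),
    a ∈ (P.path u v huv).val.support →
      (P.path u v huv).val = (P.path u a hua).val.append (P.path a v hav).val

/-- A path system is neighborly if the chosen path between the endpoints of each edge is
that single edge. -/
def Neighborly (P : PathSystem G) : Prop :=
  ∀ (u v : V) (h : G.Adj u v),
    (P.path u v h.ne).val = SimpleGraph.Walk.cons h SimpleGraph.Walk.nil

/-- The `w`-weight of a walk: the sum of the weights of its edges. -/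
def wlen (w : Sym2 V → ℝ) {u v : V} (Q : G.Walk u v) : ℝ :=
  (Q.edges.map w).sum

/-- A path system is metric if for some positive edge weights every chosen path is a
shortest path between its endpoints. -/
def Metric (P : PathSystem G) : Prop :=
  ∃ w : Sym2 V → ℝ, (∀ e ∈ G.edgeSet, 0 < w e) ∧
    ∀ (u v : V) (h : u ≠ v) (Q : G.Path u v),
      wlen w (P.path u v h).val ≤ wlen w Q.val

/-- A path system is strictly metric if for some positive edge weights every chosen path
is the unique shortest path between its endpoints. -/
def StrictlyMetric (P : PathSystem G) : Prop :=
  ∃ w : Sym2 V → ℝ, (∀ e ∈ G.edgeSet, 0 < w e) ∧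
    ∀ (u v : V) (h : u ≠ v) (Q : G.Path u v), Q ≠ P.path u v h →
      wlen w (P.path u v h).val < wlen w Q.val

end PathSystem

/-- A pointed triple `{a,b;c}` on `[n]`: an unordered pair `{a,b}` of distinct vertices
together with a distinguished third vertex `c ∉ {a,b}`. -/
abbrev PointedTriple (n : ℕ) :=
  {p : Sym2 (Fin n) × Fin n // ¬ p.1.IsDiag ∧ p.2 ∉ p.1}

/-- `ρ` is a pseudometric on `Fin n`. -/
def IsPseudometric {n : ℕ} (ρ : Fin n → Fin n → ℝ) : Prop :=
  (∀ x, ρ x x = 0) ∧ (∀ x y, ρ x y = ρ y x) ∧ ∀ x y z, ρ x z ≤ ρ x y + ρ y z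

/-- `ρ` is a metric on `Fin n`. -/
def IsMetric {n : ℕ} (ρ : Fin n → Fin n → ℝ) : Prop :=
  IsPseudometric ρ ∧ ∀ x y : Fin n, x ≠ y → 0 < ρ x y

/-- `T(ρ)`: the set of pointed triples `{a,b;c}` that are colinear w.r.t. `ρ`, i.e.
`ρ(a,b) = ρ(a,c) + ρ(c,b)`. -/
def Tpm {n : ℕ} (ρ : Fin n → Fin n → ℝ) : Set (PointedTriple n) :=
  {t | ∃ a b : Fin n, t.val.1 = s(a, b) ∧ ρ a b = ρ a t.val.2 + ρ t.val.2 b}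

/-- `T(P)`: the set of pointed triples `{a,b;c}` with `c` a vertex of the path `P_{a,b}`. -/
def Tsys {n : ℕ} (P : PathSystem (completeGraph (Fin n))) : Set (PointedTriple n) :=
  {t | ∃ (a b : Fin n) (h : a ≠ b),
    t.val.1 = s(a, b) ∧ t.val.2 ∈ (P.path a b h).val.support}

namespace PathSystem

variable {V : Type*} {G : SimpleGraph V}

@[simp] lemma wlen_nil (w : Sym2 V → ℝ) (u : V) : wlen w (Walk.nil : G.Walk u u) = 0 := rfl

@[simp] lemma wlen_cons (w : Sym2 V → ℝ) {u v x : V} (h : G.Adj u x) (p : G.Walk x v) :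
    wlen w (Walk.cons h p) = w s(u, x) + wlen w p := by
  simp [wlen]

@[simp] lemma wlen_append (w : Sym2 V → ℝ) {u v x : V} (p : G.Walk u x) (q : G.Walk x v) :
    wlen w (p.append q) = wlen w p + wlen w q := by
  simp [wlen]

@[simp] lemma wlen_reverse (w : Sym2 V → ℝ) {u v : V} (p : G.Walk u v) :
    wlen w p.reverse = wlen w p := by
  simp [wlen, List.sum_reverse]

lemma wlen_nonneg {w : Sym2 V → ℝ} (hw : ∀ e ∈ G.edgeSet, 0 < w e) {u v : V}
    (p : G.Walk u v) : 0 ≤ wlen w p := by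
  induction p with
  | nil => simp
  | cons h p ih => simpa using add_nonneg (hw _ h).le ih

lemma wlen_pos {w : Sym2 V → ℝ} (hw : ∀ e ∈ G.edgeSet, 0 < w e) {u v : V}
    (huv : u ≠ v) (p : G.Walk u v) : 0 < wlen w p := by
  cases p with
  | nil => exact (huv rfl).elim
  | cons h p => simpa using add_pos_of_pos_of_nonneg (hw _ h) (wlen_nonneg hw p)

lemma wlen_bypass_le [DecidableEq V] {w : Sym2 V → ℝ} (hw : ∀ e ∈ G.edgeSet, 0 < w e)
    {u v : V} (p : G.Walk u v) : wlen w p.bypass ≤ wlen w p := by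
  refine (p.edges_bypass_sublist_edges.map w).sum_le_sum fun x hx => ?_
  obtain ⟨e, he, rfl⟩ := List.mem_map.1 hx
  exact (hw e (p.edges_subset_edgeSet he)).le

/-- The chosen path of a metric path system is no heavier than any walk. -/
lemma wlen_path_le_walk (P : PathSystem G) {w : Sym2 V → ℝ}
    (hw : ∀ e ∈ G.edgeSet, 0 < w e)
    (hP : ∀ (u v : V) (h : u ≠ v) (Q : G.Path u v), wlen w (P.path u v h).val ≤ wlen w Q.val)
    {u v : V} (h : u ≠ v) (p : G.Walk u v) : wlen w (P.path u v h).val ≤ wlen w p := by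
  classical
  exact (hP u v h ⟨p.bypass, p.bypass_isPath⟩).trans (wlen_bypass_le hw p)

open Classical in
/-- The distance between `u` and `v` is the weight of the chosen path. -/
noncomputable def pathDist (P : PathSystem G) (w : Sym2 V → ℝ) (u v : V) : ℝ :=
  if h : u = v then 0 else wlen w (P.path u v h).val

@[simp] lemma pathDist_self (P : PathSystem G) (w : Sym2 V → ℝ) (u : V) :
    P.pathDist w u u = 0 := by
  simp [pathDist]

lemma pathDist_of_ne (P : PathSystem G) (w : Sym2 V → ℝ) {u v : V} (h : u ≠ v) :
    P.pathDist w u v = wlen w (P.path u v h).val := by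
  simp [pathDist, h]

lemma pathDist_comm (P : PathSystem G) (w : Sym2 V → ℝ) (u v : V) :
    P.pathDist w u v = P.pathDist w v u := by
  rcases eq_or_ne u v with rfl | h
  · rfl
  · rw [pathDist_of_ne P w h, pathDist_of_ne P w h.symm, P.symm u v h, wlen_reverse]

lemma pathDist_triangle (P : PathSystem G) {w : Sym2 V → ℝ}
    (hw : ∀ e ∈ G.edgeSet, 0 < w e)
    (hP : ∀ (u v : V) (h : u ≠ v) (Q : G.Path u v), wlen w (P.path u v h).val ≤ wlen w Q.val)
    (x y z : V) : P.pathDist w x z ≤ P.pathDist w x y + P.pathDist w y z := by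
  rcases eq_or_ne x y with rfl | hxy
  · simp
  rcases eq_or_ne y z with rfl | hyz
  · simp
  rw [pathDist_of_ne P w hxy, pathDist_of_ne P w hyz]
  rcases eq_or_ne x z with rfl | hxz
  · simpa using add_nonneg (wlen_nonneg hw _) (wlen_nonneg hw _)
  · rw [pathDist_of_ne P w hxz, ← wlen_append]
    exact wlen_path_le_walk P hw hP hxz _

lemma le_wlen_of_triangle {ρ : V → V → ℝ} {w : Sym2 V → ℝ} (hw : ∀ x y, w s(x, y) = ρ x y)
    (h0 : ∀ x, ρ x x = 0) (htri : ∀ x y z, ρ x z ≤ ρ x y + ρ y z) {u v : V}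
    (p : G.Walk u v) : ρ u v ≤ wlen w p := by
  induction p with
  | nil => simp [h0]
  | @cons a b c h p ih =>
    rw [wlen_cons, hw]
    linarith [htri a b c]

/-- If `ρ` is additive along the chosen paths, each of them has weight equal to the
`ρ`-distance of its endpoints. -/
lemma Consistent.wlen_path_eq {P : PathSystem G} (hP : P.Consistent) {ρ : V → V → ℝ}
    {w : Sym2 V → ℝ} (hw : ∀ x y, w s(x, y) = ρ x y)
    (hadd : ∀ (u v : V) (h : u ≠ v) (a : V), u ≠ a → a ≠ v → a ∈ (P.path u v h).val.support →
      ρ u v = ρ u a + ρ a v)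
    {u v : V} (h : u ≠ v) : wlen w (P.path u v h).val = ρ u v := by
  induction hn : (P.path u v h).val.length using Nat.strong_induction_on generalizing u v with
  | _ n ih =>
  by_cases hmid : ∃ a, u ≠ a ∧ a ≠ v ∧ a ∈ (P.path u v h).val.support
  · obtain ⟨a, hua, hav, ha⟩ := hmid
    have hsplit := hP u v h a hua hav ha
    have hlen := congrArg Walk.length hsplit
    rw [Walk.length_append] at hlen
    have hpos (x y : V) (hxy : x ≠ y) : 0 < (P.path x y hxy).val.length :=
      Nat.pos_of_ne_zero fun h0 => hxy (Walk.eq_of_length_eq_zero h0)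
    have h1 := hpos u a hua
    have h2 := hpos a v hav
    rw [hsplit, wlen_append, ih _ (by omega) hua rfl, ih _ (by omega) hav rfl,
      hadd u v h a hua hav ha]
  · push Not at hmid
    have hpath := (P.path u v h).property
    generalize (P.path u v h).val = p at hmid hpath
    cases p with
    | nil => exact (h rfl).elim
    | @cons _ b _ hub q =>
      obtain rfl : b = v := by
        by_contra hbv
        exact hmid b hub.ne hbv (by simp)
      obtain rfl : q = Walk.nil := by
        simpa using ((Walk.cons_isPath_iff _ _).1 hpath).1
      simp [hw]

end PathSystem

open PathSystem

lemma mem_Tpm_iff {n : ℕ} {ρ : Fin n → Fin n → ℝ} (hsymm : ∀ x y, ρ x y = ρ y x)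
    (t : PointedTriple n) {a b : Fin n} (hab : t.val.1 = s(a, b)) :
    t ∈ Tpm ρ ↔ ρ a b = ρ a t.val.2 + ρ t.val.2 b := by
  refine ⟨?_, fun h => ⟨a, b, hab, h⟩⟩
  rintro ⟨a', b', hab', h⟩
  rcases Sym2.eq_iff.1 (hab.symm.trans hab') with ⟨rfl, rfl⟩ | ⟨rfl, rfl⟩
  · exact h
  · rw [hsymm a b, h, hsymm b, hsymm _ a, add_comm]

theorem metric_iff_triples_subset (n : ℕ)
    (P : PathSystem (completeGraph (Fin n))) (hP : P.Consistent) :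
    P.Metric ↔ ∃ ρ : Fin n → Fin n → ℝ, IsMetric ρ ∧ Tsys P ⊆ Tpm ρ := by
  constructor
  · rintro ⟨w, hw, hmin⟩
    refine ⟨P.pathDist w, ⟨⟨P.pathDist_self w, P.pathDist_comm w, P.pathDist_triangle hw hmin⟩,
      fun x y hxy => ?_⟩, ?_⟩
    · rw [pathDist_of_ne P w hxy]
      exact wlen_pos hw hxy _
    · rintro ⟨⟨e, c⟩, hdiag, hc⟩ ⟨a, b, hab, he, hmem⟩
      obtain rfl : e = s(a, b) := he
      obtain ⟨hca, hcb⟩ : c ≠ a ∧ c ≠ b := by simpa using hc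
      refine ⟨a, b, rfl, ?_⟩
      rw [pathDist_of_ne P w hab, pathDist_of_ne P w hca.symm, pathDist_of_ne P w hcb,
        hP a b hab c hca.symm hcb hmem, wlen_append]
  · rintro ⟨ρ, ⟨⟨h0, hsymm, htri⟩, hpos⟩, hsub⟩
    let w : Sym2 (Fin n) → ℝ := Sym2.lift ⟨ρ, hsymm⟩
    have hw (x y : Fin n) : w s(x, y) = ρ x y := rfl
    refine ⟨w, ?_, fun u v h Q => ?_⟩
    · rintro ⟨x, y⟩ hxy
      exact hpos x y ((completeGraph (Fin n)).ne_of_adj hxy)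
    · refine (hP.wlen_path_eq hw ?_ h).trans_le (le_wlen_of_triangle hw h0 htri Q.val)
      intro u v h a hua hav ha
      let t : PointedTriple n := ⟨(s(u, v), a), by simpa using h, by simp [hua.symm, hav]⟩
      exact (mem_Tpm_iff hsymm t rfl).1 (hsub ⟨u, v, h, rfl, ha⟩)
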